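/- arXiv:0904.2719 — 2 statements merged into one kernel-verified Lean document; each statement's English description precedes it below -/
import Mathlib

section
/- Let δ be irrational and let τ be a real number with τ ≠ δ. For i = 1, 2 let gᵢ : ℝ² → ℝ be of the form gᵢ = lᵢ + pᵢ with lᵢ : ℝ² → ℝ linear and pᵢ : ℝ² → ℝ continuous and ℤ²-periodic. Suppose (i) there is a function G : ℝ → ℝ with g₂(x, y) − δ·g₁(x, y) = G(y − δx) for all (x, y) ∈ ℝ², and (ii) there are constants c, d ∈ ℝ with g₂(x, y) − τ·g₁(x, y) = c·(y − τx) + d for all (x, y) ∈ ℝ². Then p₁ and p₂ are constant; equivalently, g₁ and g₂ are affine functions of (x, y). -/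
/-- A continuous `1`-periodic function on `ℝ` that changes by a constant under translation by some
irrational `δ` is constant, and that constant change is zero. -/
theorem Function.Periodic.eq_of_map_add_irrational {f : ℝ → ℝ} (hf : Continuous f)
    (h1 : Function.Periodic f 1) {δ k : ℝ} (hδ : Irrational δ) (hk : ∀ s, f (s + δ) = f s + k) :
    k = 0 ∧ ∀ s, f s = f 0 := by
  have hn : ∀ n : ℕ, f (n * δ) = f 0 + n * k := by
    intro n
    induction n with
    | zero => simp
    | succ n ih =>
      have h := hk (n * δ)
      rw [ih] at h
      push_cast
      rw [add_mul, one_mul, h]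
      ring
  have hk0 : k = 0 := by
    obtain ⟨C, hC⟩ := (h1.isBounded_of_continuous one_ne_zero hf).exists_norm_le
    by_contra hne
    obtain ⟨n, hlt⟩ := exists_nat_gt (2 * C / |k|)
    rw [div_lt_iff₀ (abs_pos.2 hne)] at hlt
    have ha : |f (n * δ)| ≤ C := hC _ ⟨_, rfl⟩
    have hb : |f 0| ≤ C := hC _ ⟨_, rfl⟩
    have hsub : f (n * δ) - f 0 = n * k := by rw [hn]; ring
    have habs := abs_sub (f (n * δ)) (f 0)
    rw [hsub, abs_mul, Nat.abs_cast] at habs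
    linarith
  refine ⟨hk0, ?_⟩
  subst hk0
  have hdense : Dense (AddSubgroup.closure {1, δ} : Set ℝ) := by
    rw [dense_addSubgroupClosure_pair_iff]
    simpa using hδ.inv
  have hper : ∀ t ∈ AddSubgroup.closure {1, δ}, Function.Periodic f t := by
    intro t ht
    induction ht using AddSubgroup.closure_induction with
    | mem t ht =>
      rcases ht with rfl | rfl
      · exact h1
      · exact fun s => by simpa using hk s
    | zero => intro s; simp
    | add a b _ _ ha hb => exact ha.add_period hb
    | neg a _ ha => exact ha.neg
  exact congrFun (hf.ext_on hdense continuous_const fun t ht => (hper t ht).eq)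

/-- Linearity lemma: if `gᵢ = lᵢ + pᵢ` (linear plus `ℤ²`-periodic continuous) satisfy
`g₂ - δ g₁ = G(y - δx)` for irrational `δ` and `g₂ - τ g₁ = c (y - τ x) + d` for `τ ≠ δ`,
then the periodic parts `p₁`, `p₂` are constant, i.e. `g₁`, `g₂` are affine. -/
theorem stmt_1 (δ τ : ℝ) (hδ : Irrational δ) (hτ : τ ≠ δ)
    (l₁ l₂ : (ℝ × ℝ) →ₗ[ℝ] ℝ) (p₁ p₂ : ℝ × ℝ → ℝ)
    (hp₁ : Continuous p₁) (hp₂ : Continuous p₂)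
    (hper₁ : ∀ (q : ℝ × ℝ) (m : ℤ × ℤ), p₁ (q + ((m.1 : ℝ), (m.2 : ℝ))) = p₁ q)
    (hper₂ : ∀ (q : ℝ × ℝ) (m : ℤ × ℤ), p₂ (q + ((m.1 : ℝ), (m.2 : ℝ))) = p₂ q)
    (G : ℝ → ℝ)
    (hG : ∀ x y : ℝ,
      (l₂ (x, y) + p₂ (x, y)) - δ * (l₁ (x, y) + p₁ (x, y)) = G (y - δ * x))
    (c d : ℝ)
    (hcd : ∀ x y : ℝ,
      (l₂ (x, y) + p₂ (x, y)) - τ * (l₁ (x, y) + p₁ (x, y)) = c * (y - τ * x) + d) :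
    (∀ q q' : ℝ × ℝ, p₁ q = p₁ q') ∧ (∀ q q' : ℝ × ℝ, p₂ q = p₂ q') := by
  have e : ∀ (l : (ℝ × ℝ) →ₗ[ℝ] ℝ) (x y : ℝ), l (x, y) = x * l (1, 0) + y * l (0, 1) := by
    intro l x y
    rw [← smul_eq_mul, ← smul_eq_mul, ← map_smul, ← map_smul, ← map_add]
    simp
  have hp : ∀ x y, p₂ (x, y) = τ * p₁ (x, y) + d := by
    intro x y
    have h00 := hcd 0 0
    have h10 := hcd 1 0
    have h01 := hcd 0 1
    have hxy := hcd x y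
    have a1 := hper₁ (0, 0) (1, 0)
    have a2 := hper₂ (0, 0) (1, 0)
    have b1 := hper₁ (0, 0) (0, 1)
    have b2 := hper₂ (0, 0) (0, 1)
    simp only [Prod.mk_add_mk, Int.cast_one, Int.cast_zero, zero_add] at a1 a2 b1 b2
    rw [e l₁, e l₂] at h00 hxy
    rw [a1, a2] at h10
    rw [b1, b2] at h01
    linear_combination hxy - x * (h10 - h00) - y * (h01 - h00)
  have hne : τ - δ ≠ 0 := sub_ne_zero.2 hτ
  have key : ∀ x y, (τ - δ) * p₁ (x, y) = (τ - δ) * p₁ (0, y - δ * x)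
      + x * -(l₂ (1, 0) - δ * l₁ (1, 0) + δ * (l₂ (0, 1) - δ * l₁ (0, 1))) := by
    intro x y
    have h := hG x y
    have h' := hG 0 (y - δ * x)
    rw [mul_zero, sub_zero] at h'
    rw [e l₁, e l₂, hp] at h h'
    linear_combination h - h'
  obtain ⟨hk, hf⟩ := Function.Periodic.eq_of_map_add_irrational
    (f := fun s => (τ - δ) * p₁ (0, s)) (by fun_prop)
    (fun s => by simpa using congrArg ((τ - δ) * ·) (hper₁ (0, s) (0, 1))) hδ
    (k := -(l₂ (1, 0) - δ * l₁ (1, 0) + δ * (l₂ (0, 1) - δ * l₁ (0, 1)))) (fun s => by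
      have h := key 1 (s + δ)
      have h' := hper₁ (0, s + δ) (1, 0)
      simp only [Prod.mk_add_mk, Int.cast_one, Int.cast_zero, zero_add, add_zero] at h'
      rw [h', mul_one, add_sub_cancel_right, one_mul] at h
      exact h)
  have hconst : ∀ q, p₁ q = p₁ (0, 0) := by
    rintro ⟨x, y⟩
    refine mul_left_cancel₀ hne ?_
    rw [key, hk, mul_zero, add_zero]
    exact hf _
  refine ⟨fun q q' => by rw [hconst q, hconst q'], fun q q' => ?_⟩
  rw [← Prod.mk.eta (p := q), ← Prod.mk.eta (p := q'), hp, hp, hconst, hconst (q'.1, q'.2)]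
end

section
/- Let V = [−1,1] × [−1,1] × [0,1] ⊂ ℝ³ with coordinates (x, y, t), and let a : ℝ³ → ℝ be a C^∞ function with ∂a/∂t ≥ 0 at every point of V and ∂a/∂t(x, y, 1) > 0 for every (x, y) ∈ [−1,1] × [−1,1]. Then for every ε > 0 there exists a C^∞ function ã : ℝ³ → ℝ such that: (i) |ã(p) − a(p)| < ε for every p ∈ V; (ii) ∂ã/∂t > 0 at every point of the interior of V; and (iii) at every point of the topological boundary of V, the function ã − a vanishes together with all of its iterated derivatives of every order. -/
open Set Filter Topology

lemma expNegInvGlue_le_one (x : ℝ) : expNegInvGlue x ≤ 1 := by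
  rcases le_or_gt x 0 with h | h
  · simp [expNegInvGlue.zero_of_nonpos h]
  · rw [expNegInvGlue, if_neg h.not_ge, Real.exp_le_one_iff]
    simpa using h.le

lemma deriv_expNegInvGlue_pos {x : ℝ} (hx : 0 < x) : 0 < deriv expNegInvGlue x := by
  have hE : expNegInvGlue =ᶠ[𝓝 x] fun y => Real.exp (-y⁻¹) := by
    filter_upwards [lt_mem_nhds hx] with y hy
    rw [expNegInvGlue, if_neg hy.not_ge]
  have hd : HasDerivAt (fun y : ℝ => Real.exp (-y⁻¹)) _ x := (hasDerivAt_inv hx.ne').neg.exp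
  rw [hE.deriv_eq, hd.deriv, neg_neg]
  positivity

/-- A smooth bump that vanishes for `t ≤ 0` and `1 ≤ t` and is increasing on `(0, 1 - δ)`. -/
noncomputable def skewBump (δ t : ℝ) : ℝ :=
  expNegInvGlue t * Real.smoothTransition ((1 - t) / δ)

lemma contDiff_skewBump (δ : ℝ) : ContDiff ℝ (⊤ : ℕ∞) (skewBump δ) := by
  have h : ContDiff ℝ (⊤ : ℕ∞) fun t : ℝ => (1 - t) / δ := by fun_prop
  exact expNegInvGlue.contDiff.mul (Real.smoothTransition.contDiff.comp h)

lemma abs_skewBump_le_one (δ t : ℝ) : |skewBump δ t| ≤ 1 := by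
  rw [skewBump, abs_of_nonneg
    (mul_nonneg (expNegInvGlue.nonneg _) (Real.smoothTransition.nonneg _))]
  exact mul_le_one₀ (expNegInvGlue_le_one _) (Real.smoothTransition.nonneg _)
    (Real.smoothTransition.le_one _)

lemma skewBump_of_nonpos (δ : ℝ) {t : ℝ} (ht : t ≤ 0) : skewBump δ t = 0 := by
  simp [skewBump, expNegInvGlue.zero_of_nonpos ht]

lemma skewBump_of_one_le {δ t : ℝ} (hδ : 0 < δ) (ht : 1 ≤ t) : skewBump δ t = 0 := by
  rw [skewBump, Real.smoothTransition.zero_of_nonpos, mul_zero]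
  exact div_nonpos_of_nonpos_of_nonneg (by linarith) hδ.le

lemma deriv_skewBump_pos {δ t : ℝ} (hδ : 0 < δ) (ht : 0 < t) (ht' : t < 1 - δ) :
    0 < deriv (skewBump δ) t := by
  have hE : skewBump δ =ᶠ[𝓝 t] expNegInvGlue := by
    filter_upwards [gt_mem_nhds ht'] with s hs
    rw [skewBump, Real.smoothTransition.one_of_one_le, mul_one]
    rw [le_div_iff₀ hδ]
    linarith
  rw [hE.deriv_eq]
  exact deriv_expNegInvGlue_pos ht

/-- A smooth function vanishing outside a closed set is flat along its frontier. -/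
lemma iteratedFDeriv_eq_zero_of_mem_frontier {E F : Type*} [NormedAddCommGroup E]
    [NormedSpace ℝ E] [NormedAddCommGroup F] [NormedSpace ℝ F] {f : E → F} {s : Set E}
    (hf : ContDiff ℝ (⊤ : ℕ∞) f) (hs : IsClosed s) (hz : ∀ q ∉ s, f q = 0) {p : E}
    (hp : p ∈ frontier s) (n : ℕ) : iteratedFDeriv ℝ n f p = 0 := by
  have hc : IsClosed {q | iteratedFDeriv ℝ n f q = 0} :=
    isClosed_eq (hf.continuous_iteratedFDeriv (by exact_mod_cast le_top)) continuous_const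
  refine closure_minimal (fun q hq => ?_) hc (frontier_eq_closure_inter_closure (s := s) ▸ hp).2
  have hE : f =ᶠ[𝓝 q] fun _ => 0 := by
    filter_upwards [hs.isOpen_compl.mem_nhds hq] with r hr using hz r hr
  have := (hE.iteratedFDeriv ℝ n).eq_of_nhds
  simpa using this

lemma hasDerivAt_third_coord {a : ℝ × ℝ × ℝ → ℝ} (ha : Differentiable ℝ a) (x y t : ℝ) :
    HasDerivAt (fun s : ℝ => a (x, y, s)) (fderiv ℝ a (x, y, t) (0, 0, 1)) t := by
  have hc : HasDerivAt (fun s : ℝ => (x, y, s)) ((0 : ℝ), (0 : ℝ), (1 : ℝ)) t :=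
    (hasDerivAt_const t x).prodMk ((hasDerivAt_const t y).prodMk (hasDerivAt_id t))
  exact (ha (x, y, t)).hasFDerivAt.comp_hasDerivAt t hc

/-- A continuous function that is positive on the compact slice `K × L × {1}` is bounded below
by a positive constant on a collar `K × L × [1 - δ, 1]`. -/
lemma exists_collar_lower_bound {G : ℝ × ℝ × ℝ → ℝ} (hG : Continuous G) {K L : Set ℝ}
    (hK : IsCompact K) (hL : IsCompact L) (hpos : ∀ x ∈ K, ∀ y ∈ L, 0 < G (x, y, 1)) :
    ∃ δ > 0, ∃ c > 0, ∀ x ∈ K, ∀ y ∈ L, ∀ t ∈ Icc (1 - δ) 1, c ≤ G (x, y, t) := by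
  have hcomp : IsCompact (K ×ˢ L ×ˢ ({1} : Set ℝ)) := hK.prod (hL.prod isCompact_singleton)
  obtain ⟨δ, hδ, hsub⟩ := hcomp.exists_cthickening_subset_open
    (isOpen_lt continuous_const hG) (t := {q | 0 < G q}) (by
      rintro ⟨x, y, t⟩ ⟨hx, hy, rfl⟩
      exact hpos x hx y hy)
  have hU : ∀ q ∈ K ×ˢ L ×ˢ Icc (1 - δ) 1, 0 < G q := by
    rintro ⟨x, y, t⟩ ⟨hx, hy, ht⟩
    refine hsub (Metric.mem_cthickening_of_dist_le _ (x, y, 1) _ _ ⟨hx, hy, rfl⟩ ?_)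
    have : |t - 1| ≤ δ := abs_le.2 ⟨by linarith [ht.1], by linarith [ht.2]⟩
    simpa [Prod.dist_eq, Real.dist_eq] using this
  obtain ⟨c, hc, hcG⟩ := (hK.prod (hL.prod isCompact_Icc)).exists_forall_le' hG.continuousOn hU
  exact ⟨δ, hδ, c, hc, fun x hx y hy t ht => hcG _ ⟨hx, hy, ht⟩⟩

/-- Approximation lemma: a smooth function `a` on `V = [-1,1]×[-1,1]×[0,1]` with
`∂a/∂t ≥ 0` on `V` and `∂a/∂t > 0` on the top face `{t = 1}` can be approximated by a
smooth function `a'` with `∂a'/∂t > 0` in the interior of `V`, agreeing with `a` to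
infinite order along the boundary of `V`. -/
theorem stmt_2 (a : ℝ × ℝ × ℝ → ℝ) (ha : ContDiff ℝ (⊤ : ℕ∞) a)
    (hge : ∀ p ∈ (Set.Icc (-1 : ℝ) 1 ×ˢ Set.Icc (-1 : ℝ) 1 ×ˢ Set.Icc (0 : ℝ) 1),
      0 ≤ deriv (fun s : ℝ => a (p.1, p.2.1, s)) p.2.2)
    (hpos : ∀ x ∈ Set.Icc (-1 : ℝ) 1, ∀ y ∈ Set.Icc (-1 : ℝ) 1,
      0 < deriv (fun s : ℝ => a (x, y, s)) 1)
    (ε : ℝ) (hε : 0 < ε) :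
    ∃ a' : ℝ × ℝ × ℝ → ℝ, ContDiff ℝ (⊤ : ℕ∞) a' ∧
      (∀ p ∈ (Set.Icc (-1 : ℝ) 1 ×ˢ Set.Icc (-1 : ℝ) 1 ×ˢ Set.Icc (0 : ℝ) 1),
        |a' p - a p| < ε) ∧
      (∀ p ∈ interior (Set.Icc (-1 : ℝ) 1 ×ˢ Set.Icc (-1 : ℝ) 1 ×ˢ Set.Icc (0 : ℝ) 1),
        0 < deriv (fun s : ℝ => a' (p.1, p.2.1, s)) p.2.2) ∧
      (∀ p ∈ frontier (Set.Icc (-1 : ℝ) 1 ×ˢ Set.Icc (-1 : ℝ) 1 ×ˢ Set.Icc (0 : ℝ) 1),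
        ∀ n : ℕ, iteratedFDeriv ℝ n (fun q => a' q - a q) p = 0) := by
  have had := hasDerivAt_third_coord (ha.differentiable (by simp))
  have hG : Continuous fun q => fderiv ℝ a q (0, 0, 1) :=
    (ha.continuous_fderiv (by simp)).clm_apply continuous_const
  obtain ⟨δ, hδ, c, hc, hcollar⟩ := exists_collar_lower_bound hG isCompact_Icc isCompact_Icc
    fun x hx y hy => (had x y 1).deriv ▸ hpos x hx y hy
  have hh := contDiff_skewBump δ
  obtain ⟨M, hM⟩ := (isCompact_Icc (a := (0 : ℝ)) (b := 1)).exists_bound_of_continuousOn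
    (hh.continuous_deriv (by simp)).continuousOn
  have hM0 : 0 ≤ M := (norm_nonneg _).trans (hM 0 (by simp))
  obtain ⟨η, hη, hηε, hηc⟩ : ∃ η > 0, η < ε ∧ η * M < c := by
    refine ⟨min (ε / 2) (c / (M + 1)), by positivity,
      (min_le_left _ _).trans_lt (half_lt_self hε), ?_⟩
    calc min (ε / 2) (c / (M + 1)) * M ≤ c / (M + 1) * M := by gcongr; exact min_le_right _ _
      _ < c / (M + 1) * (M + 1) := by gcongr; linarith
      _ = c := by field_simp
  set w : ℝ → ℝ → ℝ := fun x y => η * (expNegInvGlue (1 - x ^ 2) * expNegInvGlue (1 - y ^ 2))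
    with hw
  have hw0 : ∀ x y, 0 ≤ w x y := fun x y =>
    mul_nonneg hη.le (mul_nonneg (expNegInvGlue.nonneg _) (expNegInvGlue.nonneg _))
  have hwη : ∀ x y, w x y ≤ η := fun x y => mul_le_of_le_one_right hη.le
    (mul_le_one₀ (expNegInvGlue_le_one _) (expNegInvGlue.nonneg _) (expNegInvGlue_le_one _))
  set f : ℝ × ℝ × ℝ → ℝ := fun q => w q.1 q.2.1 * skewBump δ q.2.2 with hf
  have hfs : ContDiff ℝ (⊤ : ℕ∞) f := by
    have h1 : ContDiff ℝ (⊤ : ℕ∞) fun q : ℝ × ℝ × ℝ => 1 - q.1 ^ 2 := by fun_prop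
    have h2 : ContDiff ℝ (⊤ : ℕ∞) fun q : ℝ × ℝ × ℝ => 1 - q.2.1 ^ 2 := by fun_prop
    have h3 : ContDiff ℝ (⊤ : ℕ∞) fun q : ℝ × ℝ × ℝ => q.2.2 := by fun_prop
    exact (contDiff_const.mul ((expNegInvGlue.contDiff.comp h1).mul
      (expNegInvGlue.contDiff.comp h2))).mul (hh.comp h3)
  refine ⟨fun q => a q + f q, ha.add hfs, fun p _ => ?_, ?_, fun p hp n => ?_⟩
  · rw [add_sub_cancel_left, hf, abs_mul, abs_of_nonneg (hw0 _ _)]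
    exact ((mul_le_of_le_one_right (hw0 _ _) (abs_skewBump_le_one _ _)).trans (hwη _ _)).trans_lt
      hηε
  · rintro ⟨x, y, t⟩ hp
    have hpV := interior_subset hp
    simp only [interior_prod_eq, interior_Icc, mem_prod, mem_Ioo] at hp
    obtain ⟨hx, hy, ht⟩ := hp
    have hd := (had x y t).add
      (((hh.differentiable (by simp) t).hasDerivAt).const_mul (w x y))
    have hder : deriv (fun s : ℝ => a (x, y, s) + f (x, y, s)) t = _ := hd.deriv
    have hge' := (had x y t).deriv ▸ hge _ hpV
    have hwpos : 0 < w x y := mul_pos hη (mul_pos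
      (expNegInvGlue.pos_of_pos (by nlinarith)) (expNegInvGlue.pos_of_pos (by nlinarith)))
    change 0 < deriv (fun s : ℝ => a (x, y, s) + f (x, y, s)) t
    rw [hder]
    rcases lt_or_ge t (1 - δ) with htδ | htδ
    · exact add_pos_of_nonneg_of_pos hge' (mul_pos hwpos (deriv_skewBump_pos hδ ht.1 htδ))
    · have h1 := hcollar x hpV.1 y hpV.2.1 t ⟨htδ, ht.2.le⟩
      have h2 : |w x y * deriv (skewBump δ) t| ≤ η * M := by
        rw [abs_mul, abs_of_nonneg (hw0 x y)]
        exact mul_le_mul (hwη x y) (hM t hpV.2.2) (abs_nonneg _) hη.le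
      linarith [neg_abs_le (w x y * deriv (skewBump δ) t)]
  · simp only [add_sub_cancel_left]
    refine iteratedFDeriv_eq_zero_of_mem_frontier hfs
      (isClosed_Icc.prod (isClosed_Icc.prod isClosed_Icc)) (fun q hq => ?_) hp n
    have hglue : ∀ z : ℝ, z ∉ Icc (-1 : ℝ) 1 → expNegInvGlue (1 - z ^ 2) = 0 := fun z hz =>
      expNegInvGlue.zero_of_nonpos (by
        by_contra! h
        exact hz ⟨by nlinarith, by nlinarith⟩)
    by_cases hx : q.1 ∈ Icc (-1 : ℝ) 1
    · by_cases hy : q.2.1 ∈ Icc (-1 : ℝ) 1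
      · have ht : skewBump δ q.2.2 = 0 := by
          by_contra h
          exact hq ⟨hx, hy, le_of_not_ge fun h' => h (skewBump_of_nonpos δ h'),
            le_of_not_ge fun h' => h (skewBump_of_one_le hδ h')⟩
        simp [hf, ht]
      · simp [hf, hw, hglue _ hy]
    · simp [hf, hw, hglue _ hx]
end
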